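/- For every input-total progCGS G the following implication holds: if for every path p of G from the initial state s0 there exists a set F of strategies for the agent set {ξ_N, ξ_L} such that every p' ∈ out(G, s0, F) satisfies Lab(p'(t)) ∩ (L ∪ O) = Lab(p(t)) ∩ (L ∪ O) for all t (the property stratNI), then for all paths p, p' of G from s0 there exists a path p'' of G from s0 such that Lab(p(t)) ∩ H = Lab(p''(t)) ∩ H and Lab(p'(t)) ∩ (L ∪ O) = Lab(p''(t)) ∩ (L ∪ O) for all t (generalized non-interference, GNI). -/

import Mathlib

/-- The three agents of a progCGS: `N` resolves nondeterminism,
`H` chooses high-security inputs, `L` chooses low-security inputs. -/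
inductive PAgent where
  | N | H | L
deriving DecidableEq

/-- A program concurrent game structure (progCGS) over states `S`, moves `M`,
and atomic propositions `AP`, with high-security input propositions `Hs`,
low-security input propositions `Ls` and output propositions `Os`
(pairwise disjoint, covering `AP`). -/
structure ProgCGS (S M AP : Type) where
  s0 : S
  δ : S → (PAgent → M) → S
  Lab : S → Set AP
  Hs : Set AP
  Ls : Set AP
  Os : Set AP
  disjHL : Disjoint Hs Ls
  disjHO : Disjoint Hs Os
  disjLO : Disjoint Ls Os
  cover : Hs ∪ Ls ∪ Os = Set.univ
  hm : M → Set AP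
  lm : M → Set AP
  hm_sub : ∀ m, hm m ⊆ Hs
  lm_sub : ∀ m, lm m ⊆ Ls
  labH : ∀ s σ, Lab (δ s σ) ∩ Hs = hm (σ PAgent.H)
  labL : ∀ s σ, Lab (δ s σ) ∩ Ls = lm (σ PAgent.L)
  det : ∀ s σ σ', σ PAgent.N = σ' PAgent.N → hm (σ PAgent.H) = hm (σ' PAgent.H) →
      lm (σ PAgent.L) = lm (σ' PAgent.L) → δ s σ = δ s σ'

/-- Input-total: `hm` attains every subset of `Hs` and `lm` every subset of `Ls`. -/
def ProgCGS.InputTotal {S M AP : Type} (G : ProgCGS S M AP) : Prop :=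
  (∀ v, v ⊆ G.Hs → ∃ m, G.hm m = v) ∧ (∀ v, v ⊆ G.Ls → ∃ m, G.lm m = v)

/-- The history `p(0) ⋯ p(i)`. -/
def hist {S : Type} (p : ℕ → S) (i : ℕ) : List S :=
  (List.range (i + 1)).map p

/-- `p` is a path from `s` in the game structure with transition function `δ`. -/
def IsPath {S Agent M : Type} (δ : S → (Agent → M) → S) (s : S) (p : ℕ → S) : Prop :=
  p 0 = s ∧ ∀ i, ∃ σ : Agent → M, δ (p i) σ = p (i + 1)

/-- `p ∈ out(G, s, F)`: outcomes from `s` when the agents in `A` follow the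
strategies `F`. -/
def InOut {S Agent M : Type} (δ : S → (Agent → M) → S) (A : Set Agent)
    (F : Agent → List S → M) (s : S) (p : ℕ → S) : Prop :=
  p 0 = s ∧ ∀ i, ∃ σ : Agent → M, δ (p i) σ = p (i + 1) ∧
    ∀ ξ ∈ A, σ ξ = F ξ (hist p i)

theorem hist_succ {S : Type} (p : ℕ → S) (i : ℕ) :
    hist p (i + 1) = hist p i ++ [p (i + 1)] := by
  simp [hist, List.range_succ]

/-- Recursion along histories: a sequence whose next element depends on the index,
the history so far and the current element. -/
theorem exists_seq_of_hist_step {S : Type} (s : S) (step : ℕ → List S → S → S) :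
    ∃ p : ℕ → S, p 0 = s ∧ ∀ i, p (i + 1) = step i (hist p i) (p i) := by
  let q : ℕ → List S × S := fun n =>
    Nat.rec ([s], s) (fun i x => (x.1 ++ [step i x.1 x.2], step i x.1 x.2)) n
  have hq : ∀ i, hist (fun n => (q n).2) i = (q i).1 := by
    intro i
    induction i with
    | zero => rfl
    | succ i ih => rw [hist_succ, ih]
  refine ⟨fun n => (q n).2, rfl, fun i => ?_⟩
  rw [hq]

/-- If `σ i` is a sequence of global move vectors, some outcome of the strategies `F` for
the agents in `A` has all other agents move according to `σ`. -/
theorem exists_inOut {S Agent M : Type} (δ : S → (Agent → M) → S) (A : Set Agent)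
    (F : Agent → List S → M) (s : S) (σ : ℕ → Agent → M) :
    ∃ p : ℕ → S, InOut δ A F s p ∧
      ∀ i, ∃ τ : Agent → M, δ (p i) τ = p (i + 1) ∧ ∀ ξ ∉ A, τ ξ = σ i ξ := by
  classical
  obtain ⟨p, h0, hp⟩ := exists_seq_of_hist_step s
    fun i l x => δ x fun ξ => if ξ ∈ A then F ξ l else σ i ξ
  exact ⟨p, ⟨h0, fun i => ⟨_, (hp i).symm, fun ξ hξ => if_pos hξ⟩⟩,
    fun i => ⟨_, (hp i).symm, fun ξ hξ => if_neg hξ⟩⟩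

theorem InOut.isPath {S Agent M : Type} {δ : S → (Agent → M) → S} {A : Set Agent}
    {F : Agent → List S → M} {s : S} {p : ℕ → S} (h : InOut δ A F s p) : IsPath δ s p :=
  ⟨h.1, fun i => (h.2 i).imp fun _ hσ => hσ.1⟩

/-- If an input-total progCGS satisfies stratNI then it satisfies GNI. -/
theorem stratNI_implies_GNI {S M AP : Type}
    [Fintype S] [Fintype M] [Nonempty M] [Fintype AP]
    (G : ProgCGS S M AP) (hTotal : G.InputTotal)
    (hstratNI : ∀ p : ℕ → S, IsPath G.δ G.s0 p →
      ∃ F : PAgent → List S → M,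
        ∀ p' : ℕ → S, InOut G.δ {PAgent.N, PAgent.L} F G.s0 p' →
          ∀ t, G.Lab (p' t) ∩ (G.Ls ∪ G.Os) = G.Lab (p t) ∩ (G.Ls ∪ G.Os)) :
    ∀ p p' : ℕ → S, IsPath G.δ G.s0 p → IsPath G.δ G.s0 p' →
      ∃ p'' : ℕ → S, IsPath G.δ G.s0 p'' ∧
        (∀ t, G.Lab (p t) ∩ G.Hs = G.Lab (p'' t) ∩ G.Hs) ∧
        (∀ t, G.Lab (p' t) ∩ (G.Ls ∪ G.Os) = G.Lab (p'' t) ∩ (G.Ls ∪ G.Os)) := by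
  intro p p' hp hp'
  obtain ⟨F, hF⟩ := hstratNI p' hp'
  choose σ hσ using hp.2
  obtain ⟨p'', hout, hH⟩ := exists_inOut G.δ {PAgent.N, PAgent.L} F G.s0 σ
  refine ⟨p'', hout.isPath, fun t => ?_, fun t => (hF p'' hout t).symm⟩
  cases t with
  | zero => rw [hp.1, hout.1]
  | succ i =>
    obtain ⟨τ, hτ, hτH⟩ := hH i
    rw [← hσ i, ← hτ, G.labH, G.labH, hτH PAgent.H (by simp)]
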